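/- For all 0<ε₁,d₁,d₂<1 there is ε₂>0 such that the following holds. Suppose H=(V₁,V₂,V₃;F) is a trigraph and G is a triad underlying H whose component bigraphs are all ε₂-regular with density at least d₂. Suppose (H,G) satisfies dev_{2,3}(ε₁,ε₂). Then for every sub-triad G' of G, | |F∩K₃(G')| − d_H(G)·|K₃(G')| | ≤ (2ε₁)^{1/8} d₁₂d₁₃d₂₃ |V₁||V₂||V₃|, where for 1≤i<j≤3, d_ij is the density of the component bigraph of G on (V_i,V_j). -/

import Mathlib

open scoped Classical
open Finset

set_option maxHeartbeats 1000000

/-- A 3-uniform hypergraph on a finite vertex set of naturals. -/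
structure ThreeGraph where
  verts : Finset ℕ
  edges : Finset (Finset ℕ)
  edges_sub : ∀ e ∈ edges, e ⊆ verts ∧ e.card = 3

/-- The set `Ē` of ordered triples corresponding to edges. -/
def ThreeGraph.obar (H : ThreeGraph) : Finset (ℕ × ℕ × ℕ) :=
  (H.verts ×ˢ H.verts ×ˢ H.verts).filter fun p => ({p.1, p.2.1, p.2.2} : Finset ℕ) ∈ H.edges

/-- A bigraph `(U,V;E)`. -/
structure Bigraph where
  left : Finset ℕ
  right : Finset ℕ
  edges : Finset (ℕ × ℕ)
  edges_sub : edges ⊆ left ×ˢ right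

noncomputable def Bigraph.density (B : Bigraph) : ℝ :=
  (B.edges.card : ℝ) / ((B.left.card : ℝ) * (B.right.card : ℝ))

noncomputable def Bigraph.gfun (B : Bigraph) (u w : ℕ) : ℝ :=
  if (u, w) ∈ B.edges then 1 - B.density else -B.density

noncomputable def Bigraph.devSum (B : Bigraph) : ℝ :=
  ∑ u₀ ∈ B.left, ∑ u₁ ∈ B.left, ∑ w₀ ∈ B.right, ∑ w₁ ∈ B.right,
    B.gfun u₀ w₀ * B.gfun u₀ w₁ * B.gfun u₁ w₀ * B.gfun u₁ w₁

/-- `B` has `dev₂(ε,d)`. -/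
def Bigraph.dev2 (B : Bigraph) (ε d : ℝ) : Prop :=
  |B.density - d| ≤ ε ∧ B.devSum ≤ ε * (B.left.card : ℝ) ^ 2 * (B.right.card : ℝ) ^ 2

/-- `B` has `dev₂(ε)`, i.e. `dev₂(ε, d_B)`. -/
def Bigraph.dev2self (B : Bigraph) (ε : ℝ) : Prop := B.dev2 ε B.density

noncomputable def Bigraph.dBetween (B : Bigraph) (X Y : Finset ℕ) : ℝ :=
  ((B.edges ∩ X ×ˢ Y).card : ℝ) / ((X.card : ℝ) * (Y.card : ℝ))

/-- `ε`-regularity for a bigraph. -/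
def Bigraph.EpsRegular (B : Bigraph) (ε : ℝ) : Prop :=
  ∀ X ⊆ B.left, ∀ Y ⊆ B.right,
    ε * (B.left.card : ℝ) ≤ (X.card : ℝ) → ε * (B.right.card : ℝ) ≤ (Y.card : ℝ) →
      |B.density - B.dBetween X Y| ≤ ε

/-- Irreducibility: distinct vertices have distinct neighborhoods, on both sides. -/
def Bigraph.Irreducible (B : Bigraph) : Prop :=
  (∀ u ∈ B.left, ∀ u' ∈ B.left, (∀ v : ℕ, (u, v) ∈ B.edges ↔ (u', v) ∈ B.edges) → u = u') ∧
  (∀ v ∈ B.right, ∀ v' ∈ B.right, (∀ u : ℕ, (u, v) ∈ B.edges ↔ (u, v') ∈ B.edges) → v = v')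

def Bigraph.leftNbhd (B : Bigraph) (v : ℕ) : Finset ℕ :=
  B.left.filter fun u => (u, v) ∈ B.edges

/-- `B` contains an induced copy of the abstract bigraph on `Fin k × Fin k` given by `F`. -/
def Bigraph.HasInducedPattern (B : Bigraph) (k : ℕ) (F : Fin k → Fin k → Prop) : Prop :=
  ∃ u v : Fin k → ℕ, (∀ a, u a ∈ B.left) ∧ (∀ b, v b ∈ B.right) ∧
    ∀ a b, ((u a, v b) ∈ B.edges ↔ F a b)

/-- A triad `(X,Y,Z; E_XY, E_YZ, E_XZ)`. -/
structure Triad where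
  X : Finset ℕ
  Y : Finset ℕ
  Z : Finset ℕ
  EXY : Finset (ℕ × ℕ)
  EYZ : Finset (ℕ × ℕ)
  EXZ : Finset (ℕ × ℕ)
  hXY : EXY ⊆ X ×ˢ Y
  hYZ : EYZ ⊆ Y ×ˢ Z
  hXZ : EXZ ⊆ X ×ˢ Z

def Triad.K3 (G : Triad) : Finset (ℕ × ℕ × ℕ) :=
  (G.X ×ˢ G.Y ×ˢ G.Z).filter fun p =>
    (p.1, p.2.1) ∈ G.EXY ∧ (p.2.1, p.2.2) ∈ G.EYZ ∧ (p.1, p.2.2) ∈ G.EXZ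

def Triad.bXY (G : Triad) : Bigraph := ⟨G.X, G.Y, G.EXY, G.hXY⟩
def Triad.bYZ (G : Triad) : Bigraph := ⟨G.Y, G.Z, G.EYZ, G.hYZ⟩
def Triad.bXZ (G : Triad) : Bigraph := ⟨G.X, G.Z, G.EXZ, G.hXZ⟩

/-- `d_H(G)` where the (tri)graph is given by its set `R` of ordered triples. -/
noncomputable def relDensity (R : Finset (ℕ × ℕ × ℕ)) (G : Triad) : ℝ :=
  ((R ∩ G.K3).card : ℝ) / (G.K3.card : ℝ)

noncomputable def hFun (R : Finset (ℕ × ℕ × ℕ)) (G : Triad) (x y z : ℕ) : ℝ :=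
  if (x, y, z) ∈ G.K3 then
    (if (x, y, z) ∈ R then 1 - relDensity R G else -(relDensity R G))
  else 0

noncomputable def devSum3 (R : Finset (ℕ × ℕ × ℕ)) (G : Triad) : ℝ :=
  ∑ u₀ ∈ G.X, ∑ u₁ ∈ G.X, ∑ w₀ ∈ G.Y, ∑ w₁ ∈ G.Y, ∑ z₀ ∈ G.Z, ∑ z₁ ∈ G.Z,
    hFun R G u₀ w₀ z₀ * hFun R G u₀ w₀ z₁ * hFun R G u₀ w₁ z₀ * hFun R G u₀ w₁ z₁ *
      hFun R G u₁ w₀ z₀ * hFun R G u₁ w₀ z₁ * hFun R G u₁ w₁ z₀ * hFun R G u₁ w₁ z₁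

/-- `(H,G)` has `dev_{2,3}(ε₁,ε₂)`, where the trigraph/3-graph is given by triples `R`. -/
def dev23 (R : Finset (ℕ × ℕ × ℕ)) (G : Triad) (ε₁ ε₂ : ℝ) : Prop :=
  ∃ dXY dYZ dXZ : ℝ, 0 < dXY ∧ 0 < dYZ ∧ 0 < dXZ ∧
    G.bXY.dev2 ε₂ dXY ∧ G.bXZ.dev2 ε₂ dXZ ∧ G.bYZ.dev2 ε₂ dYZ ∧
    devSum3 R G ≤ ε₁ * dXY ^ 4 * dYZ ^ 4 * dXZ ^ 4 *
      (G.X.card : ℝ) ^ 2 * (G.Y.card : ℝ) ^ 2 * (G.Z.card : ℝ) ^ 2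

/-- `G` is `μ`-homogeneous with respect to the triples `R`: `d_H(G) ∈ [0,μ) ∪ (1-μ,1]`. -/
def homTriad (R : Finset (ℕ × ℕ × ℕ)) (G : Triad) (μ : ℝ) : Prop :=
  relDensity R G < μ ∨ 1 - μ < relDensity R G

/-- A `(t,ℓ)`-decomposition of `V`, with part-indices `ι` and pair-indices `κ`. -/
structure Decomp (V : Finset ℕ) (ι κ : Type) where
  part : ι → Finset ℕ
  part_sub : ∀ i, part i ⊆ V
  part_disj : ∀ i j, i ≠ j → Disjoint (part i) (part j)
  part_cover : ∀ x ∈ V, ∃ i, x ∈ part i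
  pairs : ι → ι → κ → Finset (ℕ × ℕ)
  pairs_sub : ∀ i j α, pairs i j α ⊆ part i ×ˢ part j
  pairs_disj : ∀ i j α β, α ≠ β → Disjoint (pairs i j α) (pairs i j β)
  pairs_cover : ∀ i j, ∀ p ∈ part i ×ˢ part j, ∃ α, p ∈ pairs i j α

def Decomp.pairBG {V : Finset ℕ} {ι κ : Type} (P : Decomp V ι κ) (i j : ι) (α : κ) : Bigraph :=
  ⟨P.part i, P.part j, P.pairs i j α, P.pairs_sub i j α⟩

/-- The triad `G^{ijk}_{α,β,γ} = (V_i,V_j,V_k; P^α_{ij}, P^β_{ik}, P^γ_{jk})`. -/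
def Decomp.triadOf {V : Finset ℕ} {ι κ : Type} (P : Decomp V ι κ) (i j k : ι) (α β γ : κ) :
    Triad :=
  ⟨P.part i, P.part j, P.part k, P.pairs i j α, P.pairs j k γ, P.pairs i k β,
    P.pairs_sub i j α, P.pairs_sub j k γ, P.pairs_sub i k β⟩

/-- `P` is a `(t,ℓ,ε₁,ε₂)`-decomposition. -/
def Decomp.isReg {V : Finset ℕ} {ι κ : Type} (P : Decomp V ι κ) (ε₁ ε₂ : ℝ) : Prop :=
  (1 - ε₁) * (V.card : ℝ) ^ 2 ≤
    (((V ×ˢ V).filter fun p =>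
      ∃ i j α, p ∈ P.pairs i j α ∧ (P.pairBG i j α).dev2self ε₂).card : ℝ)

/-- `P` is equitable. -/
def Decomp.isEquitable {V : Finset ℕ} {ι κ : Type} [Fintype κ]
    (P : Decomp V ι κ) (ε₁ ε₂ : ℝ) : Prop :=
  (∀ i j, (P.part i).card ≤ (P.part j).card + 1) ∧
  (1 - ε₁) * (V.card : ℝ) ^ 2 ≤
    (((V ×ˢ V).filter fun p =>
      ∃ i j α, p ∈ P.pairs i j α ∧
        (P.pairBG i j α).dev2 ε₂ (1 / (Fintype.card κ : ℝ))).card : ℝ)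

/-- `P` is `dev_{2,3}(ε₁,ε₂)`-regular with respect to the triples `R`. -/
def Decomp.regWrt {V : Finset ℕ} {ι κ : Type} (P : Decomp V ι κ)
    (R : Finset (ℕ × ℕ × ℕ)) (ε₁ ε₂ : ℝ) : Prop :=
  (1 - ε₁) * (V.card : ℝ) ^ 3 ≤
    (((V ×ˢ V ×ˢ V).filter fun p =>
      ∃ i j k α β γ, p ∈ (P.triadOf i j k α β γ).K3 ∧
        dev23 R (P.triadOf i j k α β γ) ε₁ ε₂).card : ℝ)

/-- The triad `G^{ijk}_{α,β,γ}` of `P` is `μ`-non-trivial. -/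
def Decomp.nonTrivTriad {V : Finset ℕ} {t ℓ : ℕ} (P : Decomp V (Fin t) (Fin ℓ)) (μ : ℝ)
    (i j k : Fin t) (α β γ : Fin ℓ) : Prop :=
  μ * (V.card : ℝ) / (t : ℝ) ≤ ((P.part i).card : ℝ) ∧
  μ * (V.card : ℝ) / (t : ℝ) ≤ ((P.part j).card : ℝ) ∧
  μ * (V.card : ℝ) / (t : ℝ) ≤ ((P.part k).card : ℝ) ∧
  μ * ((P.part i).card : ℝ) * ((P.part j).card : ℝ) / (ℓ : ℝ) ≤ ((P.pairs i j α).card : ℝ) ∧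
  μ * ((P.part i).card : ℝ) * ((P.part k).card : ℝ) / (ℓ : ℝ) ≤ ((P.pairs i k β).card : ℝ) ∧
  μ * ((P.part j).card : ℝ) * ((P.part k).card : ℝ) / (ℓ : ℝ) ≤ ((P.pairs j k γ).card : ℝ)

/-- `H` has a `dev_{2,3}(ε₁,ε₂)`-regular `(t,ℓ,ε₁,ε₂)`-decomposition. -/
def GoodDecomp (H : ThreeGraph) (t ℓ : ℕ) (ε₁ ε₂ : ℝ) : Prop :=
  ∃ P : Decomp H.verts (Fin t) (Fin ℓ), P.isReg ε₁ ε₂ ∧ P.regWrt H.obar ε₁ ε₂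

def ThreeGraph.Iso (H₁ H₂ : ThreeGraph) : Prop :=
  ∃ f : ℕ → ℕ, Set.BijOn f ↑H₁.verts ↑H₂.verts ∧
    ∀ x ∈ H₁.verts, ∀ y ∈ H₁.verts, ∀ z ∈ H₁.verts,
      (({x, y, z} : Finset ℕ) ∈ H₁.edges ↔ ({f x, f y, f z} : Finset ℕ) ∈ H₂.edges)

def ThreeGraph.induce (H : ThreeGraph) (W : Finset ℕ) : ThreeGraph where
  verts := H.verts ∩ W
  edges := H.edges.filter fun e => e ⊆ W
  edges_sub := by
    intro e he
    rw [Finset.mem_filter] at he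
    obtain ⟨hsub, hcard⟩ := H.edges_sub e he.1
    exact ⟨fun x hx => Finset.mem_inter.mpr ⟨hsub hx, he.2 hx⟩, hcard⟩

/-- A hereditary property of 3-graphs. -/
def Hereditary (ℋ : Set ThreeGraph) : Prop :=
  (∀ H₁ H₂ : ThreeGraph, ThreeGraph.Iso H₁ H₂ → H₁ ∈ ℋ → H₂ ∈ ℋ) ∧
  (∀ H ∈ ℋ, ∀ W : Finset ℕ, H.induce W ∈ ℋ)

/-- The statement `ψ(ε₁,ε₂,T,L,ℋ)`. -/
def psi (ε₁ : ℝ) (ε₂ : ℕ → ℝ) (T L : ℕ) (ℋ : Set ThreeGraph) : Prop :=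
  ∃ n₀ : ℕ, ∀ H ∈ ℋ, n₀ ≤ H.verts.card →
    ∃ t ℓ : ℕ, 1 ≤ t ∧ t ≤ T ∧ 1 ≤ ℓ ∧ ℓ ≤ L ∧ GoodDecomp H t ℓ ε₁ (ε₂ ℓ)

/-- `L_ℋ(ε₁,ε₂)`: minimal `L` such that `ψ(ε₁,ε₂,T,L,ℋ)` holds for some `T ≥ 1`. -/
noncomputable def Lfun (ℋ : Set ThreeGraph) (ε₁ : ℝ) (ε₂ : ℕ → ℝ) : ℕ :=
  sInf {L : ℕ | ∃ T : ℕ, 1 ≤ T ∧ psi ε₁ ε₂ T L ℋ}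

def InZeroOne (f : ℕ → ℝ) : Prop := ∀ x, 0 < f x ∧ f x ≤ 1

/-- "For all sufficiently small `ε₁ > 0` and all `ε₂` tending to `0` sufficiently fast, `Φ`". -/
def SmallEps (Φ : ℝ → (ℕ → ℝ) → Prop) : Prop :=
  ∃ e₁ : ℝ, 0 < e₁ ∧ ∀ ε₁ : ℝ, 0 < ε₁ → ε₁ < e₁ →
    ∃ δ : ℕ → ℝ, InZeroOne δ ∧
      ∀ ε₂ : ℕ → ℝ, InZeroOne ε₂ → (∀ x, ε₂ x ≤ δ x) → Φ ε₁ ε₂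

/-- The `VC₂`-dimension of `H` is at least `k`. -/
def ThreeGraph.VC2AtLeast (H : ThreeGraph) (k : ℕ) : Prop :=
  ∃ a b : Fin k → ℕ, ∃ c : Finset (Fin k × Fin k) → ℕ,
    (∀ i, a i ∈ H.verts) ∧ (∀ i, b i ∈ H.verts) ∧ (∀ S, c S ∈ H.verts) ∧
    ∀ (i j : Fin k) (S : Finset (Fin k × Fin k)),
      (({a i, b j, c S} : Finset ℕ) ∈ H.edges ↔ (i, j) ∈ S)

/-- `K₃[A,B,C]`: the triples meeting each of `A`, `B`, `C`. -/
def K3Parts (A B C : Finset ℕ) : Finset (Finset ℕ) :=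
  (A ×ˢ B ×ˢ C).image fun p => ({p.1, p.2.1, p.2.2} : Finset ℕ)

/-- Neighborhood of `u` in the pair-set `W`, inside ambient set `V`. -/
def Nbhd (V : Finset ℕ) (W : Finset (ℕ × ℕ)) (u : ℕ) : Finset ℕ :=
  V.filter fun v => (u, v) ∈ W

/-- An edge-colored bigraph `(U,V;E₀,E₁,E₂)`. -/
structure ECBigraph where
  left : Finset ℕ
  right : Finset ℕ
  E0 : Finset (ℕ × ℕ)
  E1 : Finset (ℕ × ℕ)
  E2 : Finset (ℕ × ℕ)
  disj01 : Disjoint E0 E1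
  disj02 : Disjoint E0 E2
  disj12 : Disjoint E1 E2
  cover : E0 ∪ E1 ∪ E2 = left ×ˢ right

/-- `G` contains an `E₀/E₁`-copy of `U_bg(k)`. -/
def ECBigraph.CopyUbg (G : ECBigraph) (k : ℕ) : Prop :=
  ∃ u : Finset (Fin k) → ℕ, ∃ v : Fin k → ℕ,
    (∀ S, u S ∈ G.left) ∧ (∀ i, v i ∈ G.right) ∧
    ∀ (S : Finset (Fin k)) (i : Fin k),
      (i ∈ S → (u S, v i) ∈ G.E1) ∧ (i ∉ S → (u S, v i) ∈ G.E0)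

/-- `G` contains an `E₀/E₁`-copy of the bigraph `R`. -/
def ECBigraph.Copy01 (G : ECBigraph) (R : Bigraph) : Prop :=
  ∃ u v : ℕ → ℕ,
    (∀ a ∈ R.left, u a ∈ G.left) ∧ (∀ b ∈ R.right, v b ∈ G.right) ∧
    ∀ a ∈ R.left, ∀ b ∈ R.right,
      ((a, b) ∈ R.edges → (u a, v b) ∈ G.E1) ∧ ((a, b) ∉ R.edges → (u a, v b) ∈ G.E0)

/-- `K₂[A,B]`: the crossing (unordered) pairs. -/
def pairsAB (A B : Finset ℕ) : Finset (Finset ℕ) :=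
  (A ×ˢ B).image fun p => ({p.1, p.2} : Finset ℕ)

/-- A bipartite `U`-colored graph `Γ = (A ∪ B, (P_u)_{u ∈ U})`. -/
structure BipColored (U : Finset ℕ) where
  A : Finset ℕ
  B : Finset ℕ
  disjAB : Disjoint A B
  P : ℕ → Finset (Finset ℕ)
  P_disj : ∀ u ∈ U, ∀ u' ∈ U, u ≠ u' → Disjoint (P u) (P u')
  P_cover : U.biUnion P = pairsAB A B

/-- The bipartite graph `(A ∪ B, P_u)` of a color, as a bigraph (ordered pairs `P̄_u`). -/
def BipColored.colorBG {U : Finset ℕ} (Γ : BipColored U) (u : ℕ) : Bigraph where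
  left := Γ.A
  right := Γ.B
  edges := (Γ.A ×ˢ Γ.B).filter fun p => ({p.1, p.2} : Finset ℕ) ∈ Γ.P u
  edges_sub := Finset.filter_subset _ _

/-- `H` is an `(n,Γ)`-blowup of `G` with the explicit family `Cfam` of new vertex classes. -/
def IsBlowupWith (G : Bigraph) (n : ℕ) (Γ : BipColored G.left) (Cfam : ℕ → Finset ℕ)
    (H : ThreeGraph) : Prop :=
  (∀ v ∈ G.right, (Cfam v).card = n) ∧
  (∀ v ∈ G.right, ∀ v' ∈ G.right, v ≠ v' → Disjoint (Cfam v) (Cfam v')) ∧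
  (∀ v ∈ G.right, Disjoint (Cfam v) (Γ.A ∪ Γ.B)) ∧
  H.verts = Γ.A ∪ Γ.B ∪ G.right.biUnion Cfam ∧
  ∀ u ∈ G.left, ∀ v ∈ G.right, ∀ e ∈ Γ.P u, ∀ z ∈ Cfam v,
    (((u, v) ∈ G.edges → insert z e ∈ H.edges) ∧ ((u, v) ∉ G.edges → insert z e ∉ H.edges))

def IsBlowup (G : Bigraph) (n : ℕ) (Γ : BipColored G.left) (H : ThreeGraph) : Prop :=
  ∃ Cfam : ℕ → Finset ℕ, IsBlowupWith G n Γ Cfam H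

def ThreeGraph.ContainsInduced (H H' : ThreeGraph) : Prop :=
  ∃ W : Finset ℕ, ThreeGraph.Iso (H.induce W) H'

/-- The `G`-dimension of `H` is at least `n`. -/
def GDimAtLeast (G : Bigraph) (H : ThreeGraph) (n : ℕ) : Prop :=
  ∀ Γ : BipColored G.left, Γ.A.card = n → Γ.B.card = n →
    ∃ H' : ThreeGraph, IsBlowup G n Γ H' ∧ H.ContainsInduced H'

/-- `G ∈ B_ℋ`: `G` is irreducible and `ℋ` has infinite `G`-dimension. -/
def InBH (ℋ : Set ThreeGraph) (G : Bigraph) : Prop :=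
  G.Irreducible ∧ ∀ m : ℕ, ∃ H ∈ ℋ, GDimAtLeast G H m

/-- An encoding of the bigraph `R` in `(H,P)`, where `Rtrip = Ē(H)`. -/
def Encoding {V : Finset ℕ} {t ℓ : ℕ} (R : Bigraph) (Rtrip : Finset (ℕ × ℕ × ℕ))
    (P : Decomp V (Fin t) (Fin ℓ)) (ε₂ : ℝ) : Prop :=
  ∃ j₀ k₀ : Fin t, j₀ ≠ k₀ ∧
    ∃ f : ℕ → Fin ℓ, ∃ g : ℕ → Fin t × Fin ℓ × Fin ℓ,
      (∀ u ∈ R.left, (P.pairBG j₀ k₀ (f u)).dev2 ε₂ (1 / (ℓ : ℝ))) ∧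
      (∀ v ∈ R.right,
        (P.pairBG (g v).1 j₀ (g v).2.1).dev2 ε₂ (1 / (ℓ : ℝ)) ∧
        (P.pairBG (g v).1 k₀ (g v).2.2).dev2 ε₂ (1 / (ℓ : ℝ))) ∧
      ∀ u ∈ R.left, ∀ v ∈ R.right,
        (((u, v) ∈ R.edges →
          ((P.triadOf (g v).1 j₀ k₀ (g v).2.1 (g v).2.2 (f u)).K3.card : ℝ) / 2 ≤
            ((Rtrip ∩ (P.triadOf (g v).1 j₀ k₀ (g v).2.1 (g v).2.2 (f u)).K3).card : ℝ)) ∧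
         ((u, v) ∉ R.edges →
          ((Rtrip ∩ (P.triadOf (g v).1 j₀ k₀ (g v).2.1 (g v).2.2 (f u)).K3).card : ℝ) <
            ((P.triadOf (g v).1 j₀ k₀ (g v).2.1 (g v).2.2 (f u)).K3.card : ℝ) / 2))

def encodeSet (S : Finset ℕ) : ℕ := ∑ i ∈ S, 2 ^ i

/-- The bigraph `U_bg(k)` realized on `ℕ`, with subsets of `[k]` encoded in binary. -/
def Ubg (k : ℕ) : Bigraph where
  left := ((Finset.range k).powerset).image encodeSet
  right := Finset.range k
  edges := ((Finset.range k).powerset).biUnion fun S => S.image fun i => (encodeSet S, i)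
  edges_sub := by
    intro p hp
    simp only [Finset.mem_biUnion, Finset.mem_image, Finset.mem_powerset] at hp
    obtain ⟨S, hS, i, hi, rfl⟩ := hp
    refine Finset.mem_product.mpr ⟨?_, ?_⟩
    · exact Finset.mem_image.mpr ⟨S, Finset.mem_powerset.mpr hS, rfl⟩
    · exact hS hi

/-- Cauchy–Schwarz for a double sum. -/
lemma sq_sum_sum_mul_le (s t : Finset ℕ) (f g : ℕ → ℕ → ℝ) :
    (∑ i ∈ s, ∑ j ∈ t, f i j * g i j) ^ 2 ≤
      (∑ i ∈ s, ∑ j ∈ t, f i j ^ 2) * ∑ i ∈ s, ∑ j ∈ t, g i j ^ 2 := by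
  simp only [← Finset.sum_product']
  exact Finset.sum_mul_sq_le_sq_mul_sq _ _ _

/-- Cauchy–Schwarz for a triple sum. -/
lemma sq_sum_sum_sum_mul_le (s t u : Finset ℕ) (f g : ℕ → ℕ → ℕ → ℝ) :
    (∑ i ∈ s, ∑ j ∈ t, ∑ k ∈ u, f i j k * g i j k) ^ 2 ≤
      (∑ i ∈ s, ∑ j ∈ t, ∑ k ∈ u, f i j k ^ 2) *
        ∑ i ∈ s, ∑ j ∈ t, ∑ k ∈ u, g i j k ^ 2 := by
  simp only [← Finset.sum_product']
  exact Finset.sum_mul_sq_le_sq_mul_sq _ _ _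

/-- Cauchy–Schwarz for a quadruple sum. -/
lemma sq_sum_sum_sum_sum_mul_le (s t u v : Finset ℕ) (f g : ℕ → ℕ → ℕ → ℕ → ℝ) :
    (∑ i ∈ s, ∑ j ∈ t, ∑ k ∈ u, ∑ l ∈ v, f i j k l * g i j k l) ^ 2 ≤
      (∑ i ∈ s, ∑ j ∈ t, ∑ k ∈ u, ∑ l ∈ v, f i j k l ^ 2) *
        ∑ i ∈ s, ∑ j ∈ t, ∑ k ∈ u, ∑ l ∈ v, g i j k l ^ 2 := by
  simp only [← Finset.sum_product']
  exact Finset.sum_mul_sq_le_sq_mul_sq _ _ _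

/-- The weighted count of four-cycles of `f` on `s × t`. -/
noncomputable def fourCycleSum (s t : Finset ℕ) (f : ℕ → ℕ → ℝ) : ℝ :=
  ∑ u₀ ∈ s, ∑ u₁ ∈ s, ∑ w₀ ∈ t, ∑ w₁ ∈ t, f u₀ w₀ * f u₀ w₁ * f u₁ w₀ * f u₁ w₁

lemma fourCycleSum_eq_left (s t : Finset ℕ) (f : ℕ → ℕ → ℝ) :
    fourCycleSum s t f = ∑ u₀ ∈ s, ∑ u₁ ∈ s, (∑ w ∈ t, f u₀ w * f u₁ w) ^ 2 := by
  unfold fourCycleSum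
  refine sum_congr rfl fun u₀ _ => sum_congr rfl fun u₁ _ => ?_
  rw [sq, sum_mul_sum]
  exact sum_congr rfl fun w₀ _ => sum_congr rfl fun w₁ _ => by ring

lemma fourCycleSum_eq_right (s t : Finset ℕ) (f : ℕ → ℕ → ℝ) :
    fourCycleSum s t f = ∑ w₀ ∈ t, ∑ w₁ ∈ t, (∑ u ∈ s, f u w₀ * f u w₁) ^ 2 := by
  unfold fourCycleSum
  simp_rw [sq, sum_mul_sum]
  calc _ = ∑ u₀ ∈ s, ∑ w₀ ∈ t, ∑ u₁ ∈ s, ∑ w₁ ∈ t,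
        f u₀ w₀ * f u₀ w₁ * f u₁ w₀ * f u₁ w₁ := sum_congr rfl fun u₀ _ => sum_comm
    _ = ∑ w₀ ∈ t, ∑ u₀ ∈ s, ∑ u₁ ∈ s, ∑ w₁ ∈ t,
        f u₀ w₀ * f u₀ w₁ * f u₁ w₀ * f u₁ w₁ := sum_comm
    _ = ∑ w₀ ∈ t, ∑ u₀ ∈ s, ∑ w₁ ∈ t, ∑ u₁ ∈ s,
        f u₀ w₀ * f u₀ w₁ * f u₁ w₀ * f u₁ w₁ :=
      sum_congr rfl fun w₀ _ => sum_congr rfl fun u₀ _ => sum_comm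
    _ = ∑ w₀ ∈ t, ∑ w₁ ∈ t, ∑ u₀ ∈ s, ∑ u₁ ∈ s,
        f u₀ w₀ * f u₀ w₁ * f u₁ w₀ * f u₁ w₁ := sum_congr rfl fun w₀ _ => sum_comm
    _ = _ := by
      refine sum_congr rfl fun _ _ => sum_congr rfl fun _ _ => sum_congr rfl fun _ _ =>
        sum_congr rfl fun _ _ => by ring

lemma fourCycleSum_nonneg (s t : Finset ℕ) (f : ℕ → ℕ → ℝ) : 0 ≤ fourCycleSum s t f := by
  rw [fourCycleSum_eq_left]
  positivity

/-- The number of cherries centred in `s` is controlled by the number of four-cycles. -/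
lemma sq_cherrySum_le (s t : Finset ℕ) (f : ℕ → ℕ → ℝ) :
    (∑ u ∈ s, (∑ w ∈ t, f u w) ^ 2) ^ 2 ≤ (t.card : ℝ) ^ 2 * fourCycleSum s t f := by
  have e : ∑ u ∈ s, (∑ w ∈ t, f u w) ^ 2 =
      ∑ w₀ ∈ t, ∑ w₁ ∈ t, 1 * ∑ u ∈ s, f u w₀ * f u w₁ := by
    simp_rw [sq, sum_mul_sum, one_mul]
    rw [sum_comm]
    exact sum_congr rfl fun _ _ => sum_comm
  rw [e, fourCycleSum_eq_right]
  refine (sq_sum_sum_mul_le _ _ _ _).trans (le_of_eq ?_)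
  simp [sq]

/-- Four-cycle count of `d + g` when `g` has small four-cycle sum. -/
lemma fourCycleSum_add_le (s t : Finset ℕ) (g : ℕ → ℕ → ℝ) (d η : ℝ) (hη : 0 ≤ η)
    (hηd : 100 * η ≤ d)
    (hg : fourCycleSum s t g ≤ η ^ 4 * (s.card : ℝ) ^ 2 * (t.card : ℝ) ^ 2) :
    fourCycleSum s t (fun u w => d + g u w) ≤
      11 / 10 * d ^ 4 * (s.card : ℝ) ^ 2 * (t.card : ℝ) ^ 2 := by
  set n : ℝ := (s.card : ℝ) with hn
  set m : ℝ := (t.card : ℝ) with hm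
  have hn0 : 0 ≤ n := by positivity
  have hm0 : 0 ≤ m := by positivity
  set r : ℕ → ℝ := fun u => ∑ w ∈ t, g u w with hr
  set q : ℕ → ℕ → ℝ := fun u v => ∑ w ∈ t, g u w * g v w with hq
  have hR : ∑ u ∈ s, r u ^ 2 ≤ η ^ 2 * n * m ^ 2 := by
    refine abs_le_of_sq_le_sq' ?_ (by positivity) |>.2
    refine (sq_cherrySum_le s t g).trans ?_
    calc m ^ 2 * fourCycleSum s t g ≤ m ^ 2 * (η ^ 4 * n ^ 2 * m ^ 2) := by gcongr
      _ = _ := by ring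
  have hcod : ∀ u v, ∑ w ∈ t, (d + g u w) * (d + g v w) =
      d ^ 2 * m + d * r u + d * r v + q u v := by
    intro u v
    simp only [hr, hq, mul_sum, hm]
    rw [mul_comm (d ^ 2), ← nsmul_eq_mul, ← sum_const, ← sum_add_distrib, ← sum_add_distrib,
      ← sum_add_distrib]
    exact sum_congr rfl fun _ _ => by ring
  have hpt : ∀ u v, (d ^ 2 * m + d * r u + d * r v + q u v) ^ 2 ≤
      21 / 20 * (d ^ 2 * m) ^ 2 + 63 * (d ^ 2 * r u ^ 2 + d ^ 2 * r v ^ 2 + q u v ^ 2) := by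
    intro u v
    nlinarith [sq_nonneg (d ^ 2 * m - 20 * (d * r u + d * r v + q u v)),
      sq_nonneg (d * r u - d * r v), sq_nonneg (d * r u - q u v),
      sq_nonneg (d * r v - q u v)]
  have hsum : fourCycleSum s t (fun u w => d + g u w) ≤
      21 / 20 * (d ^ 2 * m) ^ 2 * n ^ 2 +
        63 * (2 * d ^ 2 * n * ∑ u ∈ s, r u ^ 2 + fourCycleSum s t g) := by
    rw [fourCycleSum_eq_left, fourCycleSum_eq_left s t g]
    simp_rw [hcod]
    refine (sum_le_sum fun u _ => sum_le_sum fun v _ => hpt u v).trans (le_of_eq ?_)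
    simp only [sum_add_distrib, ← mul_sum, sum_const, nsmul_eq_mul, hq]
    rw [← hn]
    ring
  have h100 : η ^ 2 * 10000 ≤ d ^ 2 := by nlinarith
  have h100' : η ^ 4 * 10000 ≤ d ^ 4 := by
    nlinarith [mul_le_mul h100 h100 (by positivity) (by positivity), sq_nonneg (η ^ 2)]
  have h3 : d ^ 2 * η ^ 2 * 10000 ≤ d ^ 4 := by
    nlinarith [mul_le_mul_of_nonneg_left h100 (sq_nonneg d)]
  calc _ ≤ 21 / 20 * (d ^ 2 * m) ^ 2 * n ^ 2 +
        63 * (2 * d ^ 2 * n * (η ^ 2 * n * m ^ 2) + η ^ 4 * n ^ 2 * m ^ 2) := by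
        refine hsum.trans ?_
        gcongr
    _ = (21 / 20 * d ^ 4 + 126 * (d ^ 2 * η ^ 2) + 63 * η ^ 4) * (n ^ 2 * m ^ 2) := by ring
    _ ≤ (11 / 10 * d ^ 4) * (n ^ 2 * m ^ 2) := by
        gcongr
        nlinarith [pow_nonneg (hη) 4, show 0 ≤ d ^ 4 by positivity]
    _ = _ := by ring

/-- Indicator function of a set of pairs. -/
noncomputable def pairInd (E : Finset (ℕ × ℕ)) (u w : ℕ) : ℝ := if (u, w) ∈ E then 1 else 0

lemma pairInd_nonneg (E : Finset (ℕ × ℕ)) (u w : ℕ) : 0 ≤ pairInd E u w := by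
  unfold pairInd; split_ifs <;> norm_num

lemma pairInd_sq (E : Finset (ℕ × ℕ)) (u w : ℕ) : pairInd E u w ^ 2 = pairInd E u w := by
  unfold pairInd; split_ifs <;> norm_num

lemma pairInd_mono {E E' : Finset (ℕ × ℕ)} (h : E' ⊆ E) (u w : ℕ) :
    pairInd E' u w ≤ pairInd E u w := by
  unfold pairInd
  split_ifs with h₁ h₂
  · exact le_rfl
  · exact absurd (h h₁) h₂
  · norm_num
  · exact le_rfl

lemma sum_pairInd (B : Bigraph) :
    ∑ u ∈ B.left, ∑ w ∈ B.right, pairInd B.edges u w = (B.edges.card : ℝ) := by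
  rw [← Finset.sum_product']
  unfold pairInd
  rw [Finset.sum_boole, Finset.filter_mem_eq_inter, Finset.inter_eq_right.mpr B.edges_sub]

lemma fourCycleSum_pairInd_mono {E E' : Finset (ℕ × ℕ)} (h : E' ⊆ E) (s t : Finset ℕ) :
    fourCycleSum s t (pairInd E') ≤ fourCycleSum s t (pairInd E) := by
  unfold fourCycleSum
  gcongr <;> first | exact pairInd_nonneg _ _ _ | exact pairInd_mono h _ _ | skip
  all_goals simp only [pairInd_nonneg, mul_nonneg]

lemma Bigraph.fourCycleSum_le (B : Bigraph) (d η : ℝ) (hη : 0 ≤ η)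
    (hηd : 100 * η ≤ B.density) (hB : B.dev2 (η ^ 4) d) :
    fourCycleSum B.left B.right (pairInd B.edges) ≤
      11 / 10 * B.density ^ 4 * (B.left.card : ℝ) ^ 2 * (B.right.card : ℝ) ^ 2 := by
  have e : pairInd B.edges = fun u w => B.density + B.gfun u w := by
    funext u w
    unfold pairInd Bigraph.gfun
    split_ifs <;> ring
  rw [e]
  exact fourCycleSum_add_le _ _ _ _ η hη hηd hB.2

/-- The octahedral sum of a function of three variables. -/
noncomputable def octSum (X Y Z : Finset ℕ) (h : ℕ → ℕ → ℕ → ℝ) : ℝ :=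
  ∑ u₀ ∈ X, ∑ u₁ ∈ X, ∑ w₀ ∈ Y, ∑ w₁ ∈ Y, ∑ z₀ ∈ Z, ∑ z₁ ∈ Z,
    h u₀ w₀ z₀ * h u₀ w₀ z₁ * h u₀ w₁ z₀ * h u₀ w₁ z₁ *
      h u₁ w₀ z₀ * h u₁ w₀ z₁ * h u₁ w₁ z₀ * h u₁ w₁ z₁

lemma octSum_eq (X Y Z : Finset ℕ) (h : ℕ → ℕ → ℕ → ℝ) :
    octSum X Y Z h = ∑ u₀ ∈ X, ∑ u₁ ∈ X, ∑ z₀ ∈ Z, ∑ z₁ ∈ Z,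
      (∑ y ∈ Y, h u₀ y z₀ * h u₀ y z₁ * h u₁ y z₀ * h u₁ y z₁) ^ 2 := by
  unfold octSum
  refine sum_congr rfl fun u₀ _ => sum_congr rfl fun u₁ _ => ?_
  simp_rw [sq, sum_mul_sum]
  calc _ = ∑ w₀ ∈ Y, ∑ z₀ ∈ Z, ∑ w₁ ∈ Y, ∑ z₁ ∈ Z,
        h u₀ w₀ z₀ * h u₀ w₀ z₁ * h u₀ w₁ z₀ * h u₀ w₁ z₁ *
      h u₁ w₀ z₀ * h u₁ w₀ z₁ * h u₁ w₁ z₀ * h u₁ w₁ z₁ := sum_congr rfl fun _ _ => sum_comm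
    _ = ∑ z₀ ∈ Z, ∑ w₀ ∈ Y, ∑ w₁ ∈ Y, ∑ z₁ ∈ Z,
        h u₀ w₀ z₀ * h u₀ w₀ z₁ * h u₀ w₁ z₀ * h u₀ w₁ z₁ *
      h u₁ w₀ z₀ * h u₁ w₀ z₁ * h u₁ w₁ z₀ * h u₁ w₁ z₁ := sum_comm
    _ = ∑ z₀ ∈ Z, ∑ w₀ ∈ Y, ∑ z₁ ∈ Z, ∑ w₁ ∈ Y,
        h u₀ w₀ z₀ * h u₀ w₀ z₁ * h u₀ w₁ z₀ * h u₀ w₁ z₁ *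
      h u₁ w₀ z₀ * h u₁ w₀ z₁ * h u₁ w₁ z₀ * h u₁ w₁ z₁ :=
      sum_congr rfl fun _ _ => sum_congr rfl fun _ _ => sum_comm
    _ = ∑ z₀ ∈ Z, ∑ z₁ ∈ Z, ∑ w₀ ∈ Y, ∑ w₁ ∈ Y,
        h u₀ w₀ z₀ * h u₀ w₀ z₁ * h u₀ w₁ z₀ * h u₀ w₁ z₁ *
      h u₁ w₀ z₀ * h u₁ w₀ z₁ * h u₁ w₁ z₀ * h u₁ w₁ z₁ := sum_congr rfl fun _ _ => sum_comm
    _ = _ := by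
      refine sum_congr rfl fun _ _ => sum_congr rfl fun _ _ => sum_congr rfl fun _ _ =>
        sum_congr rfl fun _ _ => by ring

/-- Weighted Gowers–Cauchy–Schwarz inequality for a function of three variables tested against
functions of two variables. -/
lemma sum_mul_pow_eight_le (X Y Z : Finset ℕ) (h : ℕ → ℕ → ℕ → ℝ) (a b c : ℕ → ℕ → ℝ) :
    (∑ x ∈ X, ∑ y ∈ Y, ∑ z ∈ Z, h x y z * a x y * b y z * c x z) ^ 8 ≤
      (∑ x ∈ X, ∑ y ∈ Y, a x y ^ 2) ^ 4 * (∑ y ∈ Y, (∑ z ∈ Z, b y z ^ 2) ^ 2) ^ 2 *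
        fourCycleSum X Z (fun x z => c x z ^ 2) * octSum X Y Z h := by
  set S := ∑ x ∈ X, ∑ y ∈ Y, ∑ z ∈ Z, h x y z * a x y * b y z * c x z with hS
  set A := ∑ x ∈ X, ∑ y ∈ Y, a x y ^ 2
  set B := ∑ y ∈ Y, (∑ z ∈ Z, b y z ^ 2) ^ 2 with hB
  set C := fourCycleSum X Z (fun x z => c x z ^ 2) with hC
  set T₁ := ∑ x ∈ X, ∑ y ∈ Y, (∑ z ∈ Z, h x y z * b y z * c x z) ^ 2 with hT₁
  set T₂ := ∑ y ∈ Y, ∑ z₀ ∈ Z, ∑ z₁ ∈ Z,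
    (∑ x ∈ X, h x y z₀ * h x y z₁ * c x z₀ * c x z₁) ^ 2 with hT₂
  have s1 : S ^ 2 ≤ A * T₁ := by
    refine le_trans (le_of_eq ?_) (sq_sum_sum_mul_le X Y a
      (fun x y => ∑ z ∈ Z, h x y z * b y z * c x z))
    congr 1
    refine sum_congr rfl fun _ _ => sum_congr rfl fun _ _ => ?_
    rw [mul_sum]
    exact sum_congr rfl fun _ _ => by ring
  have s2 : T₁ ^ 2 ≤ B * T₂ := by
    have e₁ : T₁ = ∑ y ∈ Y, ∑ z₀ ∈ Z, ∑ z₁ ∈ Z,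
        (b y z₀ * b y z₁) * ∑ x ∈ X, h x y z₀ * h x y z₁ * c x z₀ * c x z₁ := by
      rw [hT₁, sum_comm]
      refine sum_congr rfl fun y _ => ?_
      simp_rw [sq, sum_mul_sum, mul_sum]
      rw [sum_comm]
      refine sum_congr rfl fun z₀ _ => ?_
      rw [sum_comm]
      exact sum_congr rfl fun _ _ => sum_congr rfl fun _ _ => by ring
    have e₂ : B = ∑ y ∈ Y, ∑ z₀ ∈ Z, ∑ z₁ ∈ Z, (b y z₀ * b y z₁) ^ 2 := by
      rw [hB]
      refine sum_congr rfl fun y _ => ?_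
      rw [sq, sum_mul_sum]
      exact sum_congr rfl fun _ _ => sum_congr rfl fun _ _ => by ring
    rw [e₁, e₂]
    exact sq_sum_sum_sum_mul_le _ _ _ _ _
  have s3 : T₂ ^ 2 ≤ C * octSum X Y Z h := by
    have e₁ : T₂ = ∑ u₀ ∈ X, ∑ u₁ ∈ X, ∑ z₀ ∈ Z, ∑ z₁ ∈ Z,
        (c u₀ z₀ * c u₀ z₁ * c u₁ z₀ * c u₁ z₁) *
          ∑ y ∈ Y, h u₀ y z₀ * h u₀ y z₁ * h u₁ y z₀ * h u₁ y z₁ := by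
      have f : ∀ (D : ℕ → ℕ → ℕ → ℕ → ℕ → ℝ),
          ∑ y ∈ Y, ∑ z₀ ∈ Z, ∑ z₁ ∈ Z, ∑ u₀ ∈ X, ∑ u₁ ∈ X, D y z₀ z₁ u₀ u₁ =
          ∑ u₀ ∈ X, ∑ u₁ ∈ X, ∑ z₀ ∈ Z, ∑ z₁ ∈ Z, ∑ y ∈ Y, D y z₀ z₁ u₀ u₁ := by
        intro D
        have k := Finset.sum_comm (s := Y ×ˢ Z ×ˢ Z) (t := X ×ˢ X)
          (f := fun p r => D p.1 p.2.1 p.2.2 r.1 r.2)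
        simp only [Finset.sum_product] at k
        rw [k]
        refine sum_congr rfl fun u₀ _ => sum_congr rfl fun u₁ _ => ?_
        rw [sum_comm]
        exact sum_congr rfl fun _ _ => sum_comm
      simp_rw [hT₂, sq, sum_mul_sum, mul_sum]
      refine (f fun y z₀ z₁ u₀ u₁ => (h u₀ y z₀ * h u₀ y z₁ * c u₀ z₀ * c u₀ z₁) *
        (h u₁ y z₀ * h u₁ y z₁ * c u₁ z₀ * c u₁ z₁)).trans ?_
      refine sum_congr rfl fun u₀ _ => sum_congr rfl fun u₁ _ => sum_congr rfl fun z₀ _ =>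
        sum_congr rfl fun z₁ _ => sum_congr rfl fun y _ => ?_
      ring
    have e₂ : C = ∑ u₀ ∈ X, ∑ u₁ ∈ X, ∑ z₀ ∈ Z, ∑ z₁ ∈ Z,
        (c u₀ z₀ * c u₀ z₁ * c u₁ z₀ * c u₁ z₁) ^ 2 := by
      rw [hC, fourCycleSum]
      refine sum_congr rfl fun _ _ => sum_congr rfl fun _ _ => sum_congr rfl fun _ _ =>
        sum_congr rfl fun _ _ => by ring
    rw [e₁, e₂, octSum_eq]
    exact sq_sum_sum_sum_sum_mul_le _ _ _ _ _ _
  have hB0 : 0 ≤ B := sum_nonneg fun _ _ => sq_nonneg _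
  have hA0 : 0 ≤ A := sum_nonneg fun _ _ => sum_nonneg fun _ _ => sq_nonneg _
  have hT₁0 : 0 ≤ T₁ := sum_nonneg fun _ _ => sum_nonneg fun _ _ => sq_nonneg _
  have hT₂0 : 0 ≤ T₂ := sum_nonneg fun _ _ => sum_nonneg fun _ _ => sum_nonneg fun _ _ =>
    sq_nonneg _
  clear_value S A B C T₁ T₂
  calc S ^ 8 = (S ^ 2) ^ 4 := by ring
    _ ≤ (A * T₁) ^ 4 := by gcongr
    _ = A ^ 4 * (T₁ ^ 2) ^ 2 := by ring
    _ ≤ A ^ 4 * (B * T₂) ^ 2 := by gcongr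
    _ = A ^ 4 * B ^ 2 * T₂ ^ 2 := by ring
    _ ≤ A ^ 4 * B ^ 2 * (C * octSum X Y Z h) := by gcongr
    _ = _ := by ring

lemma Triad.mem_K3 (G : Triad) (x y z : ℕ) :
    (x, y, z) ∈ G.K3 ↔ (x, y) ∈ G.EXY ∧ (y, z) ∈ G.EYZ ∧ (x, z) ∈ G.EXZ := by
  unfold Triad.K3
  simp only [mem_filter, mem_product, and_iff_right_iff_imp]
  rintro ⟨h₁, h₂, -⟩
  have h₁ := mem_product.mp (G.hXY h₁)
  have h₂ := mem_product.mp (G.hYZ h₂)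
  exact ⟨h₁.1, h₂.1, h₂.2⟩

/-- The discrepancy of `F` on a sub-triad is the correlation of `hFun` with the three pair
indicators. -/
lemma discrepancy_eq_sum (G G' : Triad) (F : Finset (ℕ × ℕ × ℕ))
    (hXY : G'.EXY ⊆ G.EXY) (hYZ : G'.EYZ ⊆ G.EYZ) (hXZ : G'.EXZ ⊆ G.EXZ) :
    ((F ∩ G'.K3).card : ℝ) - relDensity F G * (G'.K3.card : ℝ) =
      ∑ x ∈ G.X, ∑ y ∈ G.Y, ∑ z ∈ G.Z, hFun F G x y z * pairInd G'.EXY x y *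
        pairInd G'.EYZ y z * pairInd G'.EXZ x z := by
  have hK : G'.K3 ⊆ G.X ×ˢ G.Y ×ˢ G.Z := by
    rintro ⟨x, y, z⟩ h
    obtain ⟨h₁, h₂, h₃⟩ := (G'.mem_K3 x y z).mp h
    have h₁ := mem_product.mp (G.hXY (hXY h₁))
    have h₂ := mem_product.mp (G.hYZ (hYZ h₂))
    exact mem_product.mpr ⟨h₁.1, mem_product.mpr ⟨h₁.2, h₂.2⟩⟩
  have e : ∑ x ∈ G.X, ∑ y ∈ G.Y, ∑ z ∈ G.Z, hFun F G x y z * pairInd G'.EXY x y *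
        pairInd G'.EYZ y z * pairInd G'.EXZ x z =
      ∑ p ∈ G.X ×ˢ G.Y ×ˢ G.Z, if p ∈ G'.K3 then
        ((if p ∈ F then (1 : ℝ) else 0) - relDensity F G) else 0 := by
    simp only [Finset.sum_product]
    refine sum_congr rfl fun x _ => sum_congr rfl fun y _ => sum_congr rfl fun z _ => ?_
    by_cases h : (x, y, z) ∈ G'.K3
    · obtain ⟨h₁, h₂, h₃⟩ := (G'.mem_K3 x y z).mp h
      have hG : (x, y, z) ∈ G.K3 := (G.mem_K3 x y z).mpr ⟨hXY h₁, hYZ h₂, hXZ h₃⟩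
      simp only [hFun, pairInd, h, h₁, h₂, h₃, hG, if_true, mul_one]
      split_ifs <;> ring
    · rw [if_neg h]
      rw [G'.mem_K3] at h
      unfold pairInd
      split_ifs <;> simp_all
  rw [e, ← Finset.sum_filter, Finset.filter_mem_eq_inter, Finset.inter_eq_right.mpr hK,
    Finset.sum_sub_distrib, Finset.sum_boole, Finset.filter_mem_eq_inter, Finset.inter_comm,
    sum_const, nsmul_eq_mul]
  ring

/-- Theorem 5.7 (Nagle–Rödl–Schacht): `dev_{2,3}`-quasirandomness controls sub-triads. -/
theorem stmt_13 (ε₁ d₁ d₂ : ℝ) (h1 : 0 < ε₁) (h2 : ε₁ < 1) (h3 : 0 < d₁) (h4 : d₁ < 1)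
    (h5 : 0 < d₂) (h6 : d₂ < 1) :
    ∃ ε₂ : ℝ, 0 < ε₂ ∧
      ∀ (G : Triad) (F : Finset (ℕ × ℕ × ℕ)), F ⊆ G.K3 →
        G.bXY.EpsRegular ε₂ → G.bYZ.EpsRegular ε₂ → G.bXZ.EpsRegular ε₂ →
        d₂ ≤ G.bXY.density → d₂ ≤ G.bYZ.density → d₂ ≤ G.bXZ.density →
        dev23 F G ε₁ ε₂ →
        ∀ G' : Triad, G'.X ⊆ G.X → G'.Y ⊆ G.Y → G'.Z ⊆ G.Z →
          G'.EXY ⊆ G.EXY → G'.EYZ ⊆ G.EYZ → G'.EXZ ⊆ G.EXZ →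
          |((F ∩ G'.K3).card : ℝ) - relDensity F G * (G'.K3.card : ℝ)| ≤
            (2 * ε₁) ^ ((1 : ℝ) / 8) * G.bXY.density * G.bXZ.density * G.bYZ.density *
              G.X.card * G.Y.card * G.Z.card := by
  set η : ℝ := d₂ / 100 with hη
  have hη0 : 0 < η := by positivity
  refine ⟨η ^ 4, by positivity, ?_⟩
  intro G F _ _ _ _ dXY₂ dYZ₂ dXZ₂ hdev G' _ _ _ hXY hYZ hXZ
  obtain ⟨eXY, eYZ, eXZ, pXY, pYZ, pXZ, hdXY, hdXZ, hdYZ, hoct⟩ := hdev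
  have hdens : ∀ B : Bigraph, d₂ ≤ B.density → ∀ e, B.dev2 (η ^ 4) e →
      e ≤ 101 / 100 * B.density := by
    intro B hB e he
    have h₁ := (abs_le.mp he.1).1
    have h₂ : η ^ 4 ≤ η := pow_le_of_le_one hη0.le (by linarith) (by norm_num)
    linarith
  have bXY := hdens _ dXY₂ _ hdXY
  have bYZ := hdens _ dYZ₂ _ hdYZ
  have bXZ := hdens _ dXZ₂ _ hdXZ
  have cYZ := (fourCycleSum_pairInd_mono hYZ G.Y G.Z).trans
    (G.bYZ.fourCycleSum_le eYZ η hη0.le (by linarith) hdYZ)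
  have cXZ := (fourCycleSum_pairInd_mono hXZ G.X G.Z).trans
    (G.bXZ.fourCycleSum_le eXZ η hη0.le (by linarith) hdXZ)
  have hA : ∑ x ∈ G.X, ∑ y ∈ G.Y, pairInd G'.EXY x y ≤
      G.bXY.density * (G.X.card : ℝ) * (G.Y.card : ℝ) := by
    have h₁ : ∑ x ∈ G.X, ∑ y ∈ G.Y, pairInd G'.EXY x y ≤ (G.bXY.edges.card : ℝ) := by
      rw [← sum_pairInd]
      exact sum_le_sum fun _ _ => sum_le_sum fun _ _ => pairInd_mono hXY _ _
    refine h₁.trans (le_of_eq ?_)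
    have h₂ : G.bXY.density ≠ 0 := by linarith
    have h₃ : (G.X.card : ℝ) * (G.Y.card : ℝ) ≠ 0 := by
      intro h₀
      refine h₂ ?_
      change _ / ((G.X.card : ℝ) * (G.Y.card : ℝ)) = 0
      rw [h₀, div_zero]
    rw [mul_assoc]
    exact (div_mul_cancel₀ _ h₃).symm
  have key := sum_mul_pow_eight_le G.X G.Y G.Z (hFun F G) (pairInd G'.EXY) (pairInd G'.EYZ)
    (pairInd G'.EXZ)
  rw [← discrepancy_eq_sum G G' F hXY hYZ hXZ] at key
  simp_rw [pairInd_sq] at key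
  have hB := sq_cherrySum_le G.Y G.Z (pairInd G'.EYZ)
  change octSum G.X G.Y G.Z (hFun F G) ≤ _ at hoct
  change _ ≤ 11 / 10 * G.bYZ.density ^ 4 * (G.Y.card : ℝ) ^ 2 * (G.Z.card : ℝ) ^ 2 at cYZ
  change _ ≤ 11 / 10 * G.bXZ.density ^ 4 * (G.X.card : ℝ) ^ 2 * (G.Z.card : ℝ) ^ 2 at cXZ
  have hoct0 : 0 ≤ octSum G.X G.Y G.Z (hFun F G) := by
    rw [octSum_eq]
    positivity
  have hcXZ0 := fourCycleSum_nonneg G.X G.Z (pairInd G'.EXZ)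
  have hA0 : 0 ≤ ∑ x ∈ G.X, ∑ y ∈ G.Y, pairInd G'.EXY x y :=
    sum_nonneg fun _ _ => sum_nonneg fun _ _ => pairInd_nonneg _ _ _
  set D := ((F ∩ G'.K3).card : ℝ) - relDensity F G * (G'.K3.card : ℝ)
  set p := G.bXY.density
  set q := G.bYZ.density
  set r := G.bXZ.density
  set x := (G.X.card : ℝ)
  set y := (G.Y.card : ℝ)
  set z := (G.Z.card : ℝ)
  have hp : 0 ≤ p := by linarith
  have hq : 0 ≤ q := by linarith
  have hr : 0 ≤ r := by linarith
  have hx : 0 ≤ x := Nat.cast_nonneg _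
  have hy : 0 ≤ y := Nat.cast_nonneg _
  have hz : 0 ≤ z := Nat.cast_nonneg _
  have hB' := hB.trans (mul_le_mul_of_nonneg_left cYZ (sq_nonneg z))
  have hoct' : octSum G.X G.Y G.Z (hFun F G) ≤ ε₁ * (101 / 100 * p) ^ 4 * (101 / 100 * q) ^ 4 *
      (101 / 100 * r) ^ 4 * x ^ 2 * y ^ 2 * z ^ 2 := hoct.trans (by gcongr)
  have hroot : ((2 * ε₁) ^ ((1 : ℝ) / 8)) ^ 8 = 2 * ε₁ := by
    rw [← Real.rpow_natCast, ← Real.rpow_mul (by positivity)]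
    norm_num
  refine le_of_pow_le_pow_left₀ (n := 8) (by norm_num) (by positivity) ?_
  calc |D| ^ 8 = D ^ 8 := Even.pow_abs (by decide) D
    _ ≤ (p * x * y) ^ 4 * (z ^ 2 * (11 / 10 * q ^ 4 * y ^ 2 * z ^ 2)) *
        (11 / 10 * r ^ 4 * x ^ 2 * z ^ 2) *
        (ε₁ * (101 / 100 * p) ^ 4 * (101 / 100 * q) ^ 4 *
          (101 / 100 * r) ^ 4 * x ^ 2 * y ^ 2 * z ^ 2) := by
        refine key.trans ?_
        gcongr
    _ = (11 / 10) ^ 2 * (101 / 100) ^ 12 * (ε₁ * (p * r * q * x * y * z) ^ 8) := by ring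
    _ ≤ 2 * (ε₁ * (p * r * q * x * y * z) ^ 8) := by
        gcongr
        norm_num
    _ = ((2 * ε₁) ^ ((1 : ℝ) / 8)) ^ 8 * (p * r * q * x * y * z) ^ 8 := by
        rw [hroot]
        ring
    _ = _ := by ring
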